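/- Let p be a prime with p > 3, let a be a p-integer with 1 ≤ ⟨a⟩_p ≤ (p−3)/2, and set t = (a − ⟨a⟩_p)/p; assume t ≢ −1 (mod p). Then Σ_{k=0}^{p−1} C(a,k)·C(−1−a,k)/(k + a + 1) ≡ ( (2t+1) / ( (a+1)(t+1)·C(p − 2 − ⟨a⟩_p, ⟨a⟩_p) ) ) · ( 1 + p(t+1)/(a+1) − p(2t+1)·(H_{2⟨a⟩_p + 1} − H_{⟨a⟩_p}) ) (mod p²). -/

import Mathlib

/-- A rational number is a `p`-integer if its denominator (in lowest terms)
is not divisible by `p`. -/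
def isPInt (p : ℕ) (x : ℚ) : Prop := ¬ p ∣ x.den

/-- For `p`-integers `u, v`, `u ≡ v (mod p^k)` means `(u - v)/p^k` is a `p`-integer. -/
def pCong (p k : ℕ) (u v : ℚ) : Prop := isPInt p ((u - v) / (p : ℚ) ^ k)

/-- The generalized binomial coefficient `C(a, k) = a(a-1)⋯(a-k+1)/k!`. -/
def rchoose (a : ℚ) (k : ℕ) : ℚ := (∏ i ∈ Finset.range k, (a - i)) / (k.factorial : ℚ)

/-- The subring of `p`-integers of `ℚ`. -/
def pIntegers (p : ℕ) (hp : p.Prime) : Subring ℚ where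
  carrier := {x | isPInt p x}
  mul_mem' {x y} hx hy h := by
    rcases (hp.dvd_mul).1 (h.trans (Rat.mul_den_dvd x y)) with h | h
    exacts [hx h, hy h]
  one_mem' h := hp.one_lt.ne' (by simpa using h)
  add_mem' {x y} hx hy h := by
    rcases (hp.dvd_mul).1 (h.trans (Rat.add_den_dvd x y)) with h | h
    exacts [hx h, hy h]
  zero_mem' h := hp.one_lt.ne' (by simpa using h)
  neg_mem' {x} hx h := hx (by simpa using h)

/-- The rational numbers of the form `p ^ k * c` with `c` a `p`-integer. -/
def pMultiples (p : ℕ) (hp : p.Prime) (k : ℕ) : AddSubgroup ℚ where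
  carrier := {x | x / (p : ℚ) ^ k ∈ pIntegers p hp}
  add_mem' {x y} hx hy := by
    simpa only [Set.mem_ofPred_eq, add_div] using add_mem hx hy
  zero_mem' := by simp
  neg_mem' {x} hx := by
    simpa only [Set.mem_ofPred_eq, neg_div] using neg_mem hx

section Integrality

variable {p : ℕ} {hp : p.Prime}

theorem mem_pIntegers {x : ℚ} : x ∈ pIntegers p hp ↔ isPInt p x := Iff.rfl

theorem mem_pMultiples {k : ℕ} {x : ℚ} :
    x ∈ pMultiples p hp k ↔ x / (p : ℚ) ^ k ∈ pIntegers p hp := Iff.rfl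

theorem mul_mem_pMultiples {k : ℕ} {x y : ℚ} (hx : x ∈ pIntegers p hp)
    (hy : y ∈ pMultiples p hp k) : x * y ∈ pMultiples p hp k := by
  rw [mem_pMultiples, mul_div_assoc]
  exact mul_mem hx hy

theorem pow_mul_mem_pMultiples {x : ℚ} (k : ℕ) (hx : x ∈ pIntegers p hp) :
    (p : ℚ) ^ k * x ∈ pMultiples p hp k := by
  have : (p : ℚ) ^ k ≠ 0 := pow_ne_zero _ (Nat.cast_ne_zero.2 hp.ne_zero)
  rwa [mem_pMultiples, mul_div_cancel_left₀ _ this]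

theorem mem_pMultiples_iff_exists {k : ℕ} {x : ℚ} :
    x ∈ pMultiples p hp k ↔ ∃ c ∈ pIntegers p hp, x = (p : ℚ) ^ k * c := by
  have : (p : ℚ) ^ k ≠ 0 := pow_ne_zero _ (Nat.cast_ne_zero.2 hp.ne_zero)
  refine ⟨fun h => ⟨_, h, (mul_div_cancel₀ x this).symm⟩, ?_⟩
  rintro ⟨c, hc, rfl⟩
  exact pow_mul_mem_pMultiples k hc

theorem inv_mem_pIntegers {x : ℚ} (hx : x ∈ pIntegers p hp)
    (hx' : x ∉ pMultiples p hp 1) : x⁻¹ ∈ pIntegers p hp := by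
  have hx0 : x ≠ 0 := by
    rintro rfl
    exact hx' (zero_mem _)
  rw [mem_pIntegers, isPInt]
  intro hdvd
  have hnum : (p : ℤ) ∣ x.num := by
    rw [Int.natCast_dvd]
    rwa [Rat.den_inv_of_ne_zero hx0] at hdvd
  obtain ⟨m, hm⟩ := hnum
  apply hx'
  have hp0 : (p : ℚ) ≠ 0 := Nat.cast_ne_zero.2 hp.ne_zero
  have hden : (x.den : ℚ)⁻¹ ∈ pIntegers p hp := by
    rw [mem_pIntegers, isPInt, Rat.inv_natCast_den]
    simpa using (show ¬ p ∣ x.den from hx)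
  have : x = (p : ℚ) ^ 1 * (m * (x.den : ℚ)⁻¹) := by
    conv_lhs => rw [← Rat.num_div_den x, hm]
    push_cast
    ring
  rw [this]
  exact pow_mul_mem_pMultiples 1 (mul_mem (intCast_mem _ _) hden)

theorem natCast_mem_pMultiples_one {n : ℕ} (h : (n : ℚ) ∈ pMultiples p hp 1) : p ∣ n := by
  obtain ⟨c, hc, hn⟩ := mem_pMultiples_iff_exists.1 h
  have hcd : (c.den : ℚ) ≠ 0 := Nat.cast_ne_zero.2 c.den_nz
  have h1 : ((n * c.den : ℤ) : ℚ) = ((p * c.num : ℤ) : ℚ) := by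
    rw [← Rat.num_div_den c] at hn
    push_cast
    rw [hn]
    field_simp
  have h2 : (p : ℤ) ∣ ((n * c.den : ℕ) : ℤ) := ⟨c.num, by exact_mod_cast h1⟩
  rcases (hp.dvd_mul).1 (Int.natCast_dvd_natCast.1 h2) with h | h
  exacts [h, (hc h).elim]

theorem natCast_add_notMem_pMultiples {n : ℕ} (hn : ¬ p ∣ n) {r : ℚ}
    (hr : r ∈ pIntegers p hp) : (n : ℚ) + p * r ∉ pMultiples p hp 1 := by
  intro h
  apply hn
  apply natCast_mem_pMultiples_one (hp := hp)
  have h2 := sub_mem h (pow_mul_mem_pMultiples 1 hr)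
  rwa [pow_one, add_sub_cancel_right] at h2

theorem inv_natCast_add_mem_pIntegers {n : ℕ} (hn : ¬ p ∣ n) {r : ℚ}
    (hr : r ∈ pIntegers p hp) : ((n : ℚ) + p * r)⁻¹ ∈ pIntegers p hp :=
  inv_mem_pIntegers (add_mem (natCast_mem _ _) (mul_mem (natCast_mem _ _) hr))
    (natCast_add_notMem_pMultiples hn hr)

theorem natCast_add_ne_zero {n : ℕ} (hp : p.Prime) (hn : ¬ p ∣ n) {r : ℚ}
    (hr : r ∈ pIntegers p hp) : (n : ℚ) + p * r ≠ 0 := by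
  intro h
  apply natCast_add_notMem_pMultiples hn hr
  rw [h]
  exact zero_mem _

theorem inv_natCast_mem_pIntegers {n : ℕ} (hn : ¬ p ∣ n) : (n : ℚ)⁻¹ ∈ pIntegers p hp := by
  simpa using inv_natCast_add_mem_pIntegers (hp := hp) hn (zero_mem _)

theorem inv_natCast_add_sub_inv_mem {n : ℕ} (hn : ¬ p ∣ n) {r : ℚ}
    (hr : r ∈ pIntegers p hp) : ((n : ℚ) + p * r)⁻¹ - (n : ℚ)⁻¹ ∈ pMultiples p hp 1 := by
  have h0 := natCast_add_ne_zero hp hn hr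
  have h1 : (n : ℚ) ≠ 0 := by
    rintro h
    exact hn (by simp [Nat.cast_eq_zero.1 h])
  have : ((n : ℚ) + p * r)⁻¹ - (n : ℚ)⁻¹
      = (p : ℚ) ^ 1 * (-(r * ((n : ℚ) + p * r)⁻¹ * (n : ℚ)⁻¹)) := by
    field_simp
    ring
  rw [this]
  exact pow_mul_mem_pMultiples 1 (neg_mem (mul_mem (mul_mem hr
    (inv_natCast_add_mem_pIntegers hn hr)) (inv_natCast_mem_pIntegers hn)))

/-- First-order expansion of a product of perturbed units. -/
theorem prod_natCast_add_sub_mem {m : ℕ → ℕ} {n : ℕ} (hm : ∀ i < n, ¬ p ∣ m i) {r : ℚ}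
    (hr : r ∈ pIntegers p hp) :
    (∏ i ∈ Finset.range n, ((m i : ℚ) + p * r))
      - (∏ i ∈ Finset.range n, (m i : ℚ)) * (1 + p * r * ∑ i ∈ Finset.range n, (m i : ℚ)⁻¹)
      ∈ pMultiples p hp 2 := by
  induction n with
  | zero => simp
  | succ n ih =>
    have ih := ih fun i hi => hm i (hi.trans (Nat.lt_succ_self n))
    have hmn : (m n : ℚ) ≠ 0 := by
      rintro h
      exact hm n (Nat.lt_succ_self n) (by simp [Nat.cast_eq_zero.1 h])
    rw [Finset.prod_range_succ, Finset.prod_range_succ, Finset.sum_range_succ]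
    have hS : ∑ i ∈ Finset.range n, (m i : ℚ)⁻¹ ∈ pIntegers p hp :=
      sum_mem fun i hi => inv_natCast_mem_pIntegers
        (hm i ((Finset.mem_range.1 hi).trans (Nat.lt_succ_self n)))
    have hP : ∏ i ∈ Finset.range n, (m i : ℚ) ∈ pIntegers p hp :=
      prod_mem fun i _ => natCast_mem _ _
    generalize (∑ i ∈ Finset.range n, (m i : ℚ)⁻¹) = S at *
    generalize (∏ i ∈ Finset.range n, (m i : ℚ)) = P at *
    generalize (∏ i ∈ Finset.range n, ((m i : ℚ) + p * r)) = P' at *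
    have h1 := mul_mem_pMultiples
      (add_mem (natCast_mem (pIntegers p hp) (m n)) (mul_mem (natCast_mem _ p) hr)) ih
    have h2 := pow_mul_mem_pMultiples 2 (mul_mem (mul_mem (mul_mem hP hr) hr) hS)
    convert add_mem h1 h2 using 1
    field_simp
    ring

theorem sum_inv_range_mem_pMultiples (hp2 : 2 < p) :
    ∑ k ∈ Finset.range (p - 1), ((k + 1 : ℕ) : ℚ)⁻¹ ∈ pMultiples p hp 1 := by
  have hunit : ∀ k < p - 1, ((k + 1 : ℕ) : ℚ)⁻¹ ∈ pIntegers p hp := fun k hk =>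
    inv_natCast_mem_pIntegers fun h => by
      have := Nat.le_of_dvd (Nat.succ_pos k) h
      omega
  have h2 : ((2 : ℕ) : ℚ)⁻¹ ∈ pIntegers p hp := inv_natCast_mem_pIntegers fun h => by
    have := Nat.le_of_dvd two_pos h
    omega
  have key : ∑ k ∈ Finset.range (p - 1), ((k + 1 : ℕ) : ℚ)⁻¹
      = ((2 : ℕ) : ℚ)⁻¹ * ∑ k ∈ Finset.range (p - 1),
        (((k + 1 : ℕ) : ℚ)⁻¹ + ((p - 1 - 1 - k + 1 : ℕ) : ℚ)⁻¹) := by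
    rw [Finset.sum_add_distrib,
      Finset.sum_range_reflect (fun k => ((k + 1 : ℕ) : ℚ)⁻¹) (p - 1)]
    push_cast
    ring
  rw [key]
  refine mul_mem_pMultiples h2 (sum_mem fun k hk => ?_)
  have hk := Finset.mem_range.1 hk
  have : ((k + 1 : ℕ) : ℚ)⁻¹ + ((p - 1 - 1 - k + 1 : ℕ) : ℚ)⁻¹
      = (p : ℚ) ^ 1 * (((k + 1 : ℕ) : ℚ)⁻¹ * ((p - 1 - 1 - k + 1 : ℕ) : ℚ)⁻¹) := by
    have hsum : ((k + 1 : ℕ) : ℚ) + ((p - 1 - 1 - k + 1 : ℕ) : ℚ) = p := by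
      rw [← Nat.cast_add]
      congr 1
      omega
    have e1 : ((k + 1 : ℕ) : ℚ) ≠ 0 := Nat.cast_ne_zero.2 (Nat.succ_ne_zero _)
    have e2 : ((p - 1 - 1 - k + 1 : ℕ) : ℚ) ≠ 0 := Nat.cast_ne_zero.2 (Nat.succ_ne_zero _)
    rw [← hsum]
    field_simp
    ring
  rw [this]
  exact pow_mul_mem_pMultiples 1 (mul_mem (hunit k hk) (hunit _ (by omega)))

end Integrality

theorem rchoose_succ (a : ℚ) (k : ℕ) :
    rchoose a (k + 1) = rchoose a k * (a - k) / (k + 1) := by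
  have : (k.factorial : ℚ) ≠ 0 := Nat.cast_ne_zero.2 k.factorial_ne_zero
  rw [rchoose, rchoose, Finset.prod_range_succ, Nat.factorial_succ]
  push_cast
  field_simp

theorem rchoose_mul_rchoose_succ (a : ℚ) (k : ℕ) :
    rchoose a (k + 1) * rchoose (-1 - a) (k + 1)
      = -(a * (a + k + 1)) / (k + 1) ^ 2
        * ∏ i ∈ Finset.range k, (1 - a ^ 2 / ((i : ℚ) + 1) ^ 2) := by
  induction k with
  | zero =>
    simp [rchoose]
    ring
  | succ k ih =>
    rw [rchoose_succ a, rchoose_succ (-1 - a), Finset.prod_range_succ]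
    have h1 : (k : ℚ) + 1 ≠ 0 := by positivity
    have h2 : (k : ℚ) + 1 + 1 ≠ 0 := by positivity
    push_cast
    have e : rchoose a (k + 1) * (a - (k + 1)) / (k + 1 + 1)
        * (rchoose (-1 - a) (k + 1) * (-1 - a - (k + 1)) / (k + 1 + 1))
        = rchoose a (k + 1) * rchoose (-1 - a) (k + 1)
          * ((a - (k + 1)) * (-1 - a - (k + 1)) / (k + 1 + 1) ^ 2) := by
      field_simp
    rw [e, ih]
    field_simp
    ring

theorem rchoose_sub_one_mul_rchoose_succ (a : ℚ) (k : ℕ) :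
    rchoose (a - 1) (k + 1) * rchoose (-1 - (a - 1)) (k + 1)
      = -(a * (a - k - 1)) / (k + 1) ^ 2
        * ∏ i ∈ Finset.range k, (1 - a ^ 2 / ((i : ℚ) + 1) ^ 2) := by
  have h := rchoose_mul_rchoose_succ (-a) k
  rw [show -1 - -a = a - 1 by ring, neg_sq] at h
  rw [show -1 - (a - 1) = -a by ring, mul_comm, h]
  congr 1
  ring

theorem sum_rchoose_mul_rchoose_add (a : ℚ) (n : ℕ) :
    ∑ k ∈ Finset.range (n + 1), (rchoose a k * rchoose (-1 - a) k
        + rchoose (a - 1) k * rchoose (-1 - (a - 1)) k)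
      = 2 * ∏ i ∈ Finset.range n, (1 - a ^ 2 / ((i : ℚ) + 1) ^ 2) := by
  induction n with
  | zero =>
    simp [rchoose]
    norm_num
  | succ n ih =>
    rw [Finset.sum_range_succ, ih, rchoose_mul_rchoose_succ,
      rchoose_sub_one_mul_rchoose_succ, Finset.prod_range_succ]
    have h1 : (n : ℚ) + 1 ≠ 0 := by positivity
    field_simp
    ring

theorem sum_rchoose_recurrence (a b : ℚ) (n : ℕ) (hb : ∀ k < n + 1, (k : ℚ) + b ≠ 0) :
    (a + b) * (∑ k ∈ Finset.range (n + 1), rchoose a k * rchoose (-1 - a) k / (k + b))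
      = (a - b) * (∑ k ∈ Finset.range (n + 1),
          rchoose (a - 1) k * rchoose (-1 - (a - 1)) k / (k + b))
        + 2 * ∏ i ∈ Finset.range n, (1 - a ^ 2 / ((i : ℚ) + 1) ^ 2) := by
  rw [← sum_rchoose_mul_rchoose_add, Finset.mul_sum, Finset.mul_sum, ← Finset.sum_add_distrib]
  refine Finset.sum_congr rfl fun k hk => ?_
  have hkb := hb k (Finset.mem_range.1 hk)
  have key : (a - k) * (rchoose a k * rchoose (-1 - a) k)
      = (a + k) * (rchoose (a - 1) k * rchoose (-1 - (a - 1)) k) := by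
    cases k with
    | zero => simp [rchoose]
    | succ k =>
      rw [rchoose_mul_rchoose_succ, rchoose_sub_one_mul_rchoose_succ]
      push_cast
      ring
  generalize rchoose a k * rchoose (-1 - a) k = u at *
  generalize rchoose (a - 1) k * rchoose (-1 - (a - 1)) k = v at *
  field_simp
  linear_combination key

section Congruences

variable {p : ℕ} {hp : p.Prime}

theorem not_dvd_add_one_of_lt {k : ℕ} (hk : k + 1 < p) : ¬ p ∣ k + 1 := fun h =>
  absurd (Nat.le_of_dvd k.succ_pos h) (by omega)

theorem prod_one_sub_sq_div_sub_one_mem {t : ℚ} (ht : t ∈ pIntegers p hp) {n : ℕ} (hn : n < p) :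
    (∏ i ∈ Finset.range n, (1 - (p * t) ^ 2 / ((i : ℚ) + 1) ^ 2)) - 1
      ∈ pMultiples p hp 2 := by
  induction n with
  | zero => simp
  | succ n ih =>
    have ih := ih (by omega)
    have hinv : ((n + 1 : ℕ) : ℚ)⁻¹ ∈ pIntegers p hp :=
      inv_natCast_mem_pIntegers (not_dvd_add_one_of_lt hn)
    have hc : t * ((n + 1 : ℕ) : ℚ)⁻¹ ∈ pIntegers p hp := mul_mem ht hinv
    rw [Finset.prod_range_succ]
    generalize (∏ i ∈ Finset.range n, (1 - ((p : ℚ) * t) ^ 2 / ((i : ℚ) + 1) ^ 2)) = P at *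
    have h1 := mul_mem_pMultiples (sub_mem (one_mem _)
      (mul_mem (natCast_mem _ p) (mul_mem (natCast_mem _ p) (mul_mem hc hc)))) ih
    have h2 := pow_mul_mem_pMultiples 2 (mul_mem hc hc)
    convert sub_mem h1 h2 using 1
    push_cast
    field_simp
    ring

/-- The sum of `1 / (k + 1) - 1 / (k + 1 + b)` over all `k < p - 1` for which `k + 1 + b` is
a unit is congruent to `2 / b`. -/
theorem sum_inv_sub_inv_sub_mem (hp2 : 2 < p) {t : ℚ} (ht : t ∈ pIntegers p hp) {A m : ℕ}
    (hm : p = A + 2 + m) {b : ℚ} (hb : b = ((A + 1 : ℕ) : ℚ) + p * t) :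
    (∑ k ∈ Finset.range m, (((k + 1 : ℕ) : ℚ)⁻¹ - (((k + 1 : ℕ) : ℚ) + b)⁻¹)
      + ∑ k ∈ Finset.range A,
        (((m + 1 + k + 1 : ℕ) : ℚ)⁻¹ - (((m + 1 + k + 1 : ℕ) : ℚ) + b)⁻¹)) - 2 * b⁻¹
      ∈ pMultiples p hp 1 := by
  have hH := sum_inv_range_mem_pMultiples (hp := hp) hp2
  have hH1 : ∑ k ∈ Finset.range (p - 1), ((k + 1 : ℕ) : ℚ)⁻¹
      = ∑ k ∈ Finset.range m, ((k + 1 : ℕ) : ℚ)⁻¹ + ((m + 1 : ℕ) : ℚ)⁻¹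
        + ∑ k ∈ Finset.range A, ((m + 1 + k + 1 : ℕ) : ℚ)⁻¹ := by
    rw [show p - 1 = m + 1 + A by omega, Finset.sum_range_add, Finset.sum_range_succ]
  have hH2 : ∑ k ∈ Finset.range (p - 1), ((k + 1 : ℕ) : ℚ)⁻¹
      = ∑ k ∈ Finset.range A, ((k + 1 : ℕ) : ℚ)⁻¹ + ((A + 1 : ℕ) : ℚ)⁻¹
        + ∑ k ∈ Finset.range m, ((A + 1 + k + 1 : ℕ) : ℚ)⁻¹ := by
    rw [show p - 1 = A + 1 + m by omega, Finset.sum_range_add, Finset.sum_range_succ]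
  have hlow : ∑ k ∈ Finset.range m, ((((k + 1 : ℕ) : ℚ) + b)⁻¹ - ((A + 1 + k + 1 : ℕ) : ℚ)⁻¹)
      ∈ pMultiples p hp 1 := sum_mem fun k hk => by
    have hk := Finset.mem_range.1 hk
    convert inv_natCast_add_sub_inv_mem (hp := hp) (n := A + 1 + k + 1)
      (not_dvd_add_one_of_lt (by omega)) ht using 3
    rw [hb]
    push_cast
    ring
  have hhigh : ∑ k ∈ Finset.range A,
      ((((m + 1 + k + 1 : ℕ) : ℚ) + b)⁻¹ - ((k + 1 : ℕ) : ℚ)⁻¹) ∈ pMultiples p hp 1 :=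
    sum_mem fun k hk => by
      have hk := Finset.mem_range.1 hk
      convert inv_natCast_add_sub_inv_mem (hp := hp) (n := k + 1)
        (not_dvd_add_one_of_lt (by omega)) (add_mem ht (one_mem _)) using 3
      have hpq : (p : ℚ) = A + 2 + m := by exact_mod_cast hm
      rw [hb]
      push_cast
      linear_combination -hpq
  have hm1 : ((m + 1 : ℕ) : ℚ)⁻¹ + ((A + 1 : ℕ) : ℚ)⁻¹ ∈ pMultiples p hp 1 := by
    have h1 := inv_natCast_mem_pIntegers (hp := hp) (n := m + 1)
      (not_dvd_add_one_of_lt (by omega))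
    have h2 := inv_natCast_mem_pIntegers (hp := hp) (n := A + 1)
      (not_dvd_add_one_of_lt (by omega))
    convert pow_mul_mem_pMultiples 1 (mul_mem h1 h2) using 1
    have hpq : (p : ℚ) = A + 2 + m := by exact_mod_cast hm
    have e1 : (m : ℚ) + 1 ≠ 0 := by positivity
    have e2 : (A : ℚ) + 1 ≠ 0 := by positivity
    rw [hpq]
    push_cast
    field_simp
    ring
  have hbi : b⁻¹ - ((A + 1 : ℕ) : ℚ)⁻¹ ∈ pMultiples p hp 1 := by
    rw [hb]
    exact inv_natCast_add_sub_inv_mem (not_dvd_add_one_of_lt (by omega)) ht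
  rw [Finset.sum_sub_distrib] at hlow hhigh ⊢
  rw [Finset.sum_sub_distrib]
  have hHH := hH
  rw [hH1] at hH
  rw [hH2] at hHH
  convert sub_mem (sub_mem (sub_mem (sub_mem (sub_mem hH hHH) hlow) hhigh) hm1)
    (add_mem hbi hbi) using 1
  ring

/-- The case `a = p * t`. -/
theorem sum_rchoose_natCast_mul_sub_mem (hp2 : 2 < p) {t : ℚ} (ht : t ∈ pIntegers p hp)
    (ht1 : t + 1 ≠ 0) (ht1' : (t + 1)⁻¹ ∈ pIntegers p hp) {A m : ℕ}
    (hm : p = A + 2 + m) {b : ℚ} (hb : b = ((A + 1 : ℕ) : ℚ) + p * t) :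
    (∑ k ∈ Finset.range p, rchoose (p * t) k * rchoose (-1 - p * t) k / ((k : ℚ) + b))
      - (2 * t + 1) * (t + 1)⁻¹ * b⁻¹ * (1 - p * t * b⁻¹) ∈ pMultiples p hp 2 := by
  have hpq : (p : ℚ) = A + 2 + m := by exact_mod_cast hm
  have hp0 : (p : ℚ) ≠ 0 := Nat.cast_ne_zero.2 hp.ne_zero
  have hb0 : b ≠ 0 := hb ▸ natCast_add_ne_zero hp (not_dvd_add_one_of_lt (by omega)) ht
  have hbm : b ∈ pIntegers p hp :=
    hb ▸ add_mem (natCast_mem _ _) (mul_mem (natCast_mem _ _) ht)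
  have hbi : b⁻¹ ∈ pIntegers p hp :=
    hb ▸ inv_natCast_add_mem_pIntegers (not_dvd_add_one_of_lt (by omega)) ht
  have hgen : ∀ k : ℕ, k + 1 < p → ((k + 1 : ℕ) : ℚ) + b ≠ 0 →
      (((k + 1 : ℕ) : ℚ) + b)⁻¹ ∈ pIntegers p hp →
      rchoose (p * t) (k + 1) * rchoose (-1 - p * t) (k + 1) / (((k + 1 : ℕ) : ℚ) + b)
        + p * (t * b⁻¹ * (((k + 1 : ℕ) : ℚ)⁻¹ - (((k + 1 : ℕ) : ℚ) + b)⁻¹))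
        ∈ pMultiples p hp 2 := by
    intro k hk hkb hkb'
    have hQ := prod_one_sub_sq_div_sub_one_mem ht (n := k) (by omega)
    have hki : ((k + 1 : ℕ) : ℚ)⁻¹ ∈ pIntegers p hp :=
      inv_natCast_mem_pIntegers (not_dvd_add_one_of_lt hk)
    have hk0 : ((k + 1 : ℕ) : ℚ) ≠ 0 := Nat.cast_ne_zero.2 k.succ_ne_zero
    rw [rchoose_mul_rchoose_succ]
    rw [show p * t + k + 1 = p * t + ((k + 1 : ℕ) : ℚ) by push_cast; ring,
      show (k : ℚ) + 1 = ((k + 1 : ℕ) : ℚ) by push_cast; ring]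
    generalize (∏ i ∈ Finset.range k, (1 - ((p : ℚ) * t) ^ 2 / ((i : ℚ) + 1) ^ 2)) = Q at *
    generalize ((k + 1 : ℕ) : ℚ) = K at *
    have hpt : (p : ℚ) * t ∈ pIntegers p hp := mul_mem (natCast_mem _ p) ht
    have h1 := mul_mem_pMultiples (mul_mem (mul_mem hpt hkb') (add_mem (mul_mem hpt
      (mul_mem hki hki)) hki)) hQ
    have h2 := pow_mul_mem_pMultiples 2 (mul_mem (mul_mem ht ht) (mul_mem hkb'
      (mul_mem hki hki)))
    convert neg_mem (add_mem h1 h2) using 1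
    field_simp
    ring
  have hspec : rchoose (p * t) (m + 1) * rchoose (-1 - p * t) (m + 1) / (((m + 1 : ℕ) : ℚ) + b)
      - (t * (t + 1)⁻¹ * (b⁻¹ + p * b⁻¹ ^ 2)) ∈ pMultiples p hp 2 := by
    have hQ := prod_one_sub_sq_div_sub_one_mem ht (n := m) (by omega)
    have hki : ((m + 1 : ℕ) : ℚ)⁻¹ ∈ pIntegers p hp :=
      inv_natCast_mem_pIntegers (not_dvd_add_one_of_lt (by omega))
    have hk0 : ((m + 1 : ℕ) : ℚ) ≠ 0 := Nat.cast_ne_zero.2 m.succ_ne_zero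
    have hKb : ((m + 1 : ℕ) : ℚ) + b = p * (t + 1) := by
      rw [hb]
      push_cast
      linear_combination -hpq
    rw [rchoose_mul_rchoose_succ, hKb]
    rw [show p * t + m + 1 = p * t + ((m + 1 : ℕ) : ℚ) by push_cast; ring,
      show (m : ℚ) + 1 = ((m + 1 : ℕ) : ℚ) by push_cast; ring]
    generalize (∏ i ∈ Finset.range m, (1 - ((p : ℚ) * t) ^ 2 / ((i : ℚ) + 1) ^ 2)) = Q at *
    generalize ((m + 1 : ℕ) : ℚ) = K at *
    have hpt : (p : ℚ) * t ∈ pIntegers p hp := mul_mem (natCast_mem _ p) ht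
    have h1 := mul_mem_pMultiples (mul_mem (mul_mem ht ht1') (add_mem (mul_mem hpt
      (mul_mem hki hki)) hki)) hQ
    have hs : t + 1 ∈ pIntegers p hp := add_mem ht (one_mem _)
    have hr : (t + 1) * ((t - 1) * b + p * (t + 1)) ∈ pIntegers p hp :=
      mul_mem hs (add_mem (mul_mem (sub_mem ht (one_mem _)) hbm)
        (mul_mem (natCast_mem _ p) hs))
    have h2 := pow_mul_mem_pMultiples 2 (mul_mem (mul_mem (mul_mem ht ht1')
      (mul_mem (mul_mem hbi hbi) (mul_mem hki hki))) hr)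
    convert neg_mem (add_mem h1 h2) using 1
    obtain rfl : K = p * (t + 1) - b := by linear_combination hKb
    field_simp
    ring
  have hT := sum_inv_sub_inv_sub_mem hp2 ht hm hb
  have hlow := sum_mem (S := pMultiples p hp 2) (t := Finset.range m) fun k hk => by
    have hk := Finset.mem_range.1 hk
    have e : ((k + 1 : ℕ) : ℚ) + b = ((A + 1 + k + 1 : ℕ) : ℚ) + p * t := by
      rw [hb]
      push_cast
      ring
    have hd : ¬ p ∣ A + 1 + k + 1 := not_dvd_add_one_of_lt (by omega)
    exact hgen k (by omega) (e ▸ natCast_add_ne_zero hp hd ht)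
      (e ▸ inv_natCast_add_mem_pIntegers hd ht)
  have hhigh := sum_mem (S := pMultiples p hp 2) (t := Finset.range A) fun k hk => by
    have hk := Finset.mem_range.1 hk
    have e : ((m + 1 + k + 1 : ℕ) : ℚ) + b = ((k + 1 : ℕ) : ℚ) + p * (t + 1) := by
      rw [hb]
      push_cast
      linear_combination -hpq
    have hd : ¬ p ∣ k + 1 := not_dvd_add_one_of_lt (by omega)
    have ht' := add_mem ht (one_mem _)
    exact hgen (m + 1 + k) (by omega) (e ▸ natCast_add_ne_zero hp hd ht')
      (e ▸ inv_natCast_add_mem_pIntegers hd ht')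
  obtain ⟨c, hc, hcT⟩ := mem_pMultiples_iff_exists.1 hT
  have hT2 := pow_mul_mem_pMultiples 2 (mul_mem (mul_mem ht hbi) hc)
  rw [Finset.sum_add_distrib, ← Finset.mul_sum, ← Finset.mul_sum] at hlow hhigh
  have hsplit : ∀ f : ℕ → ℚ, ∑ k ∈ Finset.range p, f k
      = ∑ k ∈ Finset.range m, f (k + 1) + f (m + 1)
        + ∑ k ∈ Finset.range A, f (m + 1 + k + 1) + f 0 := fun f => by
    rw [show Finset.range p = Finset.range (m + 1 + A + 1) by congr 1; omega,
      Finset.sum_range_succ', Finset.sum_range_add, Finset.sum_range_succ]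
  have h0 : rchoose (p * t) 0 * rchoose (-1 - p * t) 0 / (((0 : ℕ) : ℚ) + b) = b⁻¹ := by
    simp [rchoose]
  rw [hsplit, h0]
  convert sub_mem (add_mem (add_mem hlow hhigh) hspec) hT2 using 1
  have e : (p : ℚ) ^ 2 * (t * b⁻¹ * c) = p * (t * b⁻¹) * ((p : ℚ) ^ 1 * c) := by ring
  rw [e, ← hcT]
  generalize (∑ k ∈ Finset.range m, (((k + 1 : ℕ) : ℚ)⁻¹ - (((k + 1 : ℕ) : ℚ) + b)⁻¹)) = S₁
  generalize (∑ k ∈ Finset.range A,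
    (((m + 1 + k + 1 : ℕ) : ℚ)⁻¹ - (((m + 1 + k + 1 : ℕ) : ℚ) + b)⁻¹)) = S₂
  field_simp
  ring

/-- The boundary term of the recurrence vanishes modulo `p ^ 2`. -/
theorem prod_one_sub_sq_div_mem {t : ℚ} (ht : t ∈ pIntegers p hp) {j : ℕ} (hj : 0 < j)
    (hjp : 2 * j < p) :
    ∏ i ∈ Finset.range (p - 1), (1 - ((j : ℚ) + p * t) ^ 2 / ((i : ℚ) + 1) ^ 2)
      ∈ pMultiples p hp 2 := by
  have hj1 : j - 1 ∈ Finset.range (p - 1) := Finset.mem_range.2 (by omega)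
  have hj2 : p - j - 1 ∈ (Finset.range (p - 1)).erase (j - 1) :=
    Finset.mem_erase.2 ⟨by omega, Finset.mem_range.2 (by omega)⟩
  rw [← Finset.mul_prod_erase _ _ hj1, ← Finset.mul_prod_erase _ _ hj2]
  have hinv : ∀ i < p - 1, ((i + 1 : ℕ) : ℚ)⁻¹ ∈ pIntegers p hp := fun i hi =>
    inv_natCast_mem_pIntegers (not_dvd_add_one_of_lt (by omega))
  have hjt : (j : ℚ) + p * t ∈ pIntegers p hp :=
    add_mem (natCast_mem _ _) (mul_mem (natCast_mem _ _) ht)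
  have hrest : ∏ i ∈ ((Finset.range (p - 1)).erase (j - 1)).erase (p - j - 1),
      (1 - ((j : ℚ) + p * t) ^ 2 / ((i : ℚ) + 1) ^ 2) ∈ pIntegers p hp :=
    prod_mem fun i hi => by
      have hi := hinv i (Finset.mem_range.1 (Finset.mem_of_mem_erase (Finset.mem_of_mem_erase hi)))
      have h := sub_mem (one_mem _) (pow_mem (mul_mem hjt hi) 2)
      rwa [mul_pow, inv_pow, ← div_eq_mul_inv, Nat.cast_succ] at h
  generalize (∏ i ∈ ((Finset.range (p - 1)).erase (j - 1)).erase (p - j - 1),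
      (1 - ((j : ℚ) + p * t) ^ 2 / ((i : ℚ) + 1) ^ 2)) = P at *
  have h1 := hinv (j - 1) (by omega)
  have h2 := hinv (p - j - 1) (by omega)
  have e1 : ((j - 1 : ℕ) : ℚ) + 1 = j := by
    rw [← Nat.cast_succ]
    congr 1
    omega
  have e2 : ((p - j - 1 : ℕ) : ℚ) + 1 = p - j := by
    rw [← Nat.cast_succ, ← Nat.cast_sub (by omega)]
    congr 1
    omega
  rw [Nat.cast_succ, e1] at h1
  rw [Nat.cast_succ, e2] at h2
  rw [e1, e2]
  have hj0 : (j : ℚ) ≠ 0 := Nat.cast_ne_zero.2 hj.ne'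
  have hpj0 : (p : ℚ) - j ≠ 0 := by
    rw [← e2]
    positivity
  have hn1 : -t * (2 * j + p * t) ∈ pIntegers p hp :=
    mul_mem (neg_mem ht) (add_mem (mul_mem (ofNat_mem _ 2) (natCast_mem _ _))
      (mul_mem (natCast_mem _ _) ht))
  have hn2 : (p - 2 * j - p * t) * (1 + t) ∈ pIntegers p hp :=
    mul_mem (sub_mem (sub_mem (natCast_mem _ _) (mul_mem (ofNat_mem _ 2) (natCast_mem _ _)))
      (mul_mem (natCast_mem _ _) ht)) (add_mem (one_mem _) ht)
  convert pow_mul_mem_pMultiples 2 (mul_mem (mul_mem hn1 hn2)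
    (mul_mem (mul_mem (pow_mem h1 2) (pow_mem h2 2)) hrest)) using 1
  field_simp
  ring

/-- The recurrence in `a`, iterated from `a = p * t` to `a = j + p * t`. -/
theorem sum_rchoose_mul_prod_sub_mem {t : ℚ} (ht : t ∈ pIntegers p hp)
    {A : ℕ} (hA : 2 * A + 2 < p) {b : ℚ} (hb : b = ((A + 1 : ℕ) : ℚ) + p * t)
    (hb0 : ∀ k < p, (k : ℚ) + b ≠ 0) {j : ℕ} (hj : j ≤ A) :
    (∑ k ∈ Finset.range p,
        rchoose (j + p * t) k * rchoose (-1 - (j + p * t)) k / ((k : ℚ) + b))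
        * (∏ i ∈ Finset.range j, (((A + 2 + i : ℕ) : ℚ) + p * (2 * t)))
      - (∏ i ∈ Finset.range j, ((i : ℚ) - A))
        * (∑ k ∈ Finset.range p, rchoose (p * t) k * rchoose (-1 - p * t) k / ((k : ℚ) + b))
      ∈ pMultiples p hp 2 := by
  induction j with
  | zero => simp
  | succ j ih =>
    have ih := ih (by omega)
    have hrec := sum_rchoose_recurrence (((j + 1 : ℕ) : ℚ) + p * t) b (p - 1)
      fun k hk => hb0 k (by omega)
    rw [show p - 1 + 1 = p by omega,
      show ((j + 1 : ℕ) : ℚ) + p * t - 1 = j + p * t by push_cast; ring] at hrec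
    have hbd := prod_one_sub_sq_div_mem ht (j := j + 1) (by omega) (by omega)
    rw [Finset.prod_range_succ, Finset.prod_range_succ]
    have hP : ∏ i ∈ Finset.range j, (((A + 2 + i : ℕ) : ℚ) + p * (2 * t)) ∈ pIntegers p hp :=
      prod_mem fun i _ => add_mem (natCast_mem _ _)
        (mul_mem (natCast_mem _ _) (mul_mem (ofNat_mem _ 2) ht))
    have h1 := mul_mem_pMultiples (sub_mem (natCast_mem (pIntegers p hp) j) (natCast_mem _ A)) ih
    have h2 := mul_mem_pMultiples (mul_mem (ofNat_mem (pIntegers p hp) 2) hP) hbd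
    convert add_mem h1 h2 using 1
    rw [hb] at hrec ⊢
    push_cast at hrec ⊢
    linear_combination (∏ i ∈ Finset.range j, ((A : ℚ) + 2 + i + p * (2 * t))) * hrec

theorem inv_prod_natCast_add_mem {m : ℕ → ℕ} {n : ℕ} (hm : ∀ i < n, ¬ p ∣ m i) {r : ℚ}
    (hr : r ∈ pIntegers p hp) :
    (∏ i ∈ Finset.range n, ((m i : ℚ) + p * r))⁻¹ ∈ pIntegers p hp := by
  rw [← Finset.prod_inv_distrib]
  exact prod_mem fun i hi => inv_natCast_add_mem_pIntegers (hm i (Finset.mem_range.1 hi)) hr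

end Congruences

theorem choose_mul_prod_sub (n A : ℕ) (h : A ≤ n) :
    (n.choose A : ℚ) * ∏ i ∈ Finset.range A, ((i : ℚ) - A)
      = ∏ i ∈ Finset.range A, ((i : ℚ) - n) := by
  have hneg : ∀ k : ℕ, A ≤ k → ∏ i ∈ Finset.range A, ((i : ℚ) - k)
      = (-1) ^ A * (k.descFactorial A : ℚ) := fun k hk => by
    have hc := Finset.prod_const (s := Finset.range A) (-1 : ℚ)
    rw [Finset.card_range] at hc
    rw [Nat.descFactorial_eq_prod_range, Nat.cast_prod, ← hc, ← Finset.prod_mul_distrib]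
    refine Finset.prod_congr rfl fun i hi => ?_
    rw [Nat.cast_sub ((Finset.mem_range.1 hi).le.trans hk)]
    ring
  rw [hneg A le_rfl, hneg n h, Nat.descFactorial_self, Nat.descFactorial_eq_factorial_mul_choose]
  push_cast
  ring

theorem harmonic_two_mul_add_one_sub (A : ℕ) :
    harmonic (2 * A + 1) - harmonic A
      = ((A + 1 : ℕ) : ℚ)⁻¹ + ∑ i ∈ Finset.range A, ((A + 2 + i : ℕ) : ℚ)⁻¹ := by
  rw [harmonic, harmonic, show 2 * A + 1 = A + 1 + A by ring, Finset.sum_range_add,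
    Finset.sum_range_succ, add_assoc, add_sub_cancel_left]
  congr 1
  refine Finset.sum_congr rfl fun i _ => ?_
  rw [show A + 1 + i + 1 = A + 2 + i by ring]

theorem stmt2 (p : ℕ) (hp : p.Prime) (hp3 : 3 < p) (a : ℚ) (A : ℕ)
    (ha : isPInt p a) (hA : A < p) (haA : pCong p 1 a (A : ℚ))
    (hA1 : 1 ≤ A) (hA2 : A ≤ (p - 3) / 2)
    (ht : ¬ pCong p 1 ((a - A) / p) (-1)) :
    pCong p 2
      (∑ k ∈ Finset.range p, rchoose a k * rchoose (-1 - a) k / ((k : ℚ) + a + 1))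
      ((2 * ((a - A) / p) + 1) /
          ((a + 1) * (((a - A) / p) + 1) * ((p - 2 - A).choose A : ℚ)) *
        (1 + (p : ℚ) * (((a - A) / p) + 1) / (a + 1)
          - (p : ℚ) * (2 * ((a - A) / p) + 1) * (harmonic (2 * A + 1) - harmonic A))) := by
  have hA3 : 2 * A + 3 ≤ p := by omega
  have hp0 : (p : ℚ) ≠ 0 := Nat.cast_ne_zero.2 hp.ne_zero
  obtain ⟨t, rfl⟩ : ∃ t, a = A + p * t := ⟨(a - A) / p, by field_simp; ring⟩
  have et : ((A : ℚ) + p * t - A) / p = t := by field_simp; ring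
  have htR : t ∈ pIntegers p hp := by
    rwa [pCong, pow_one, et] at haA
  rw [et] at ht ⊢
  have hs : t + 1 ∈ pIntegers p hp := add_mem htR (one_mem _)
  have hs' : t + 1 ∉ pMultiples p hp 1 := by rwa [← sub_neg_eq_add]
  have hsi := inv_mem_pIntegers hs hs'
  have hs0 : t + 1 ≠ 0 := fun h => hs' (h ▸ zero_mem _)
  obtain ⟨b, hb⟩ : ∃ b : ℚ, b = ((A + 1 : ℕ) : ℚ) + p * t := ⟨_, rfl⟩
  have hab : (A : ℚ) + p * t + 1 = b := by
    rw [hb]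
    push_cast
    ring
  have hdA : ¬ p ∣ A + 1 := not_dvd_add_one_of_lt (by omega)
  have hbi : b⁻¹ ∈ pIntegers p hp := hb ▸ inv_natCast_add_mem_pIntegers hdA htR
  have hb0 : b ≠ 0 := hb ▸ natCast_add_ne_zero hp hdA htR
  have hkb : ∀ k < p, (k : ℚ) + b ≠ 0 := by
    intro k hk
    rcases lt_trichotomy (k + A + 1) p with h | h | h
    · convert natCast_add_ne_zero hp (not_dvd_add_one_of_lt h) htR using 1
      rw [hb]
      push_cast
      ring
    · convert mul_ne_zero hp0 hs0 using 1
      have : (p : ℚ) = k + A + 1 := by exact_mod_cast h.symm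
      rw [hb]
      push_cast
      linear_combination -this
    · obtain ⟨c, hc⟩ := Nat.exists_eq_add_of_lt h
      convert natCast_add_ne_zero hp (not_dvd_add_one_of_lt (k := c) (by omega)) hs using 1
      have : (k : ℚ) + A + 1 = p + c + 1 := by exact_mod_cast hc
      rw [hb]
      push_cast
      linear_combination this
  have hunit : ∀ i < A, ¬ p ∣ A + 2 + i := fun i hi => by
    rw [show A + 2 + i = A + 1 + i + 1 by ring]
    exact not_dvd_add_one_of_lt (by omega)
  have ht2 : 2 * t ∈ pIntegers p hp := mul_mem (ofNat_mem _ 2) htR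
  have hneg : (-1 : ℚ) ∈ pIntegers p hp := neg_mem (one_mem _)
  have hbase := sum_rchoose_natCast_mul_sub_mem (by omega) htR hs0 hsi
    (show p = A + 2 + (p - 2 - A) by omega) hb
  have hiter := sum_rchoose_mul_prod_sub_mem htR (by omega) hb hkb le_rfl
  have hP := prod_natCast_add_sub_mem hunit ht2
  have hP' := prod_natCast_add_sub_mem hunit hneg
  have hPi := inv_prod_natCast_add_mem hunit ht2
  have hPi' := inv_prod_natCast_add_mem hunit hneg
  have hP0 : ∏ i ∈ Finset.range A, (((A + 2 + i : ℕ) : ℚ) + p * (2 * t)) ≠ 0 :=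
    Finset.prod_ne_zero_iff.2 fun i hi =>
      natCast_add_ne_zero hp (hunit i (Finset.mem_range.1 hi)) ht2
  have hP0' : ∏ i ∈ Finset.range A, (((A + 2 + i : ℕ) : ℚ) + p * (-1)) ≠ 0 :=
    Finset.prod_ne_zero_iff.2 fun i hi =>
      natCast_add_ne_zero hp (hunit i (Finset.mem_range.1 hi)) hneg
  have hchoose : ((p - 2 - A).choose A : ℚ) * ∏ i ∈ Finset.range A, ((i : ℚ) - A)
      = ∏ i ∈ Finset.range A, (((A + 2 + i : ℕ) : ℚ) + p * (-1)) := by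
    rw [choose_mul_prod_sub _ _ (by omega)]
    refine Finset.prod_congr rfl fun i _ => ?_
    rw [Nat.cast_sub (by omega), Nat.cast_sub (by omega)]
    push_cast
    ring
  have hh : ∑ i ∈ Finset.range A, ((A + 2 + i : ℕ) : ℚ)⁻¹ ∈ pIntegers p hp :=
    sum_mem fun i hi => inv_natCast_mem_pIntegers (hunit i (Finset.mem_range.1 hi))
  have hQ : ∏ i ∈ Finset.range A, ((A + 2 + i : ℕ) : ℚ) ∈ pIntegers p hp :=
    prod_mem fun i _ => natCast_mem _ _
  have hN : ∏ i ∈ Finset.range A, ((i : ℚ) - A) ∈ pIntegers p hp :=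
    prod_mem fun i _ => sub_mem (natCast_mem _ _) (natCast_mem _ _)
  have hβ : ((A + 1 : ℕ) : ℚ)⁻¹ ∈ pIntegers p hp := inv_natCast_mem_pIntegers hdA
  have hβ0 : ((A + 1 : ℕ) : ℚ) ≠ 0 := Nat.cast_ne_zero.2 A.succ_ne_zero
  simp_rw [add_assoc ((_ : ℕ) : ℚ) ((A : ℚ) + p * t) 1, hab]
  rw [harmonic_two_mul_add_one_sub]
  change _ ∈ pMultiples p hp 2
  generalize (∑ k ∈ Finset.range p, rchoose (A + p * t) k * rchoose (-1 - (A + p * t)) k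
    / ((k : ℚ) + b)) = G at *
  generalize (∑ k ∈ Finset.range p, rchoose (p * t) k * rchoose (-1 - p * t) k
    / ((k : ℚ) + b)) = F at *
  generalize (∏ i ∈ Finset.range A, (((A + 2 + i : ℕ) : ℚ) + p * (2 * t))) = P at *
  generalize (∏ i ∈ Finset.range A, (((A + 2 + i : ℕ) : ℚ) + p * (-1))) = P' at *
  generalize (∏ i ∈ Finset.range A, ((A + 2 + i : ℕ) : ℚ)) = Q at *
  generalize (∏ i ∈ Finset.range A, ((i : ℚ) - A)) = N at *
  generalize (∑ i ∈ Finset.range A, ((A + 2 + i : ℕ) : ℚ)⁻¹) = h at *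
  generalize ((p - 2 - A).choose A : ℚ) = C at *
  generalize ((A + 1 : ℕ) : ℚ) = B at *
  have hpR : (p : ℚ) ∈ pIntegers p hp := natCast_mem _ p
  have hu : 2 * t + 1 ∈ pIntegers p hp := add_mem ht2 (one_mem _)
  have hY : (t + 1) * b⁻¹ - (2 * t + 1) * (B⁻¹ + h) ∈ pIntegers p hp :=
    sub_mem (mul_mem hs hbi) (mul_mem hu (add_mem hβ hh))
  obtain ⟨Y, eY⟩ : ∃ Y, Y = (t + 1) * b⁻¹ - (2 * t + 1) * (B⁻¹ + h) := ⟨_, rfl⟩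
  rw [← eY] at hY
  have hbracket : (1 - p * t * b⁻¹) * P' - (1 + p * Y) * P ∈ pMultiples p hp 2 := by
    have h1 := mul_mem_pMultiples (sub_mem (one_mem _) (mul_mem (mul_mem hpR htR) hbi)) hP'
    have h2 := mul_mem_pMultiples (add_mem (one_mem _) (mul_mem hpR hY)) hP
    have h3 := pow_mul_mem_pMultiples 2 (mul_mem hQ (sub_mem (add_mem (mul_mem (mul_mem htR hh)
      hbi) (mul_mem (mul_mem (mul_mem hu htR) hβ) hbi)) (mul_mem (mul_mem ht2 hh) hY)))
    have eβ : B⁻¹ - b⁻¹ = p * t * B⁻¹ * b⁻¹ := by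
      rw [hb] at hb0 ⊢
      field_simp
      ring
    convert add_mem (sub_mem h1 h2) h3 using 1
    linear_combination (-Q * p) * eY + (Q * p * (2 * t + 1)) * eβ
  have h1 := mul_mem_pMultiples hPi hiter
  have h2 := mul_mem_pMultiples (mul_mem hN hPi) hbase
  have h3 := mul_mem_pMultiples (mul_mem (mul_mem hN (mul_mem (mul_mem hu hsi) hbi))
    (mul_mem hPi hPi')) hbracket
  convert add_mem (add_mem h1 h2) h3 using 1
  have hC0 : C ≠ 0 := left_ne_zero_of_mul (hchoose ▸ hP0')
  have hN0 : N ≠ 0 := right_ne_zero_of_mul (hchoose ▸ hP0')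
  have eX : 1 + p * (t + 1) / b - p * (2 * t + 1) * (B⁻¹ + h) = 1 + p * Y := by
    rw [eY]
    ring
  rw [eX, ← hchoose]
  field_simp
  ring
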